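/- arXiv:2004.11770 — 3 statements merged into one kernel-verified Lean document; each statement's English description precedes it below -/
import Mathlib

section
/- Let β ∈ (0,2) and let F, G be probability measures on ℝ^d with finite β-th moments and one-dimensional coordinate marginals F₁,…,F_d and G₁,…,G_d respectively. For each i, let Q_i : (0,1) → [0,∞) be the quantile function (generalized inverse of the cdf) of the distribution of |X_i − Y_i|, where X_i ∼ F_i and Y_i ∼ G_i are independent. Then S_β(F,G) ≥ ∫₀¹ ( Σ_{i=1}^d Q_i(u)² )^{β/2} du. -/
open MeasureTheory Set

/-- The Euclidean distance `‖x - y‖₂` on `ℝ^d`. -/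
noncomputable def dist2 {d : ℕ} (x y : Fin d → ℝ) : ℝ := Real.sqrt (∑ i, (x i - y i) ^ 2)

/-- `S_β(F,G) = ∫∫ ‖x-y‖₂^β F(dx) G(dy)`. -/
noncomputable def Sb (d : ℕ) (β : ℝ) (F G : Measure (Fin d → ℝ)) : ℝ :=
  ∫ x, ∫ y, dist2 x y ^ β ∂G ∂F

/-- The Euclidean norm `‖x‖₂` on `ℝ^d`. -/
noncomputable def euclNorm {d : ℕ} (x : Fin d → ℝ) : ℝ := Real.sqrt (∑ i, (x i) ^ 2)

/-- The quantile function (generalized inverse of the cdf) of a measure on `ℝ`. -/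
noncomputable def quantileFun (μ : Measure ℝ) (u : ℝ) : ℝ :=
  sInf {t : ℝ | u ≤ (μ (Set.Iic t)).toReal}

/-- The law of `|X_i - Y_i|` where `X_i` has the `i`-th marginal of `F`,
`Y_i` the `i`-th marginal of `G`, independent. -/
noncomputable def absDiffLaw (d : ℕ) (F G : Measure (Fin d → ℝ)) (i : Fin d) : Measure ℝ :=
  Measure.map (fun p : ℝ × ℝ => |p.1 - p.2|)
    ((Measure.map (fun x => x i) F).prod (Measure.map (fun x => x i) G))


namespace QAux

lemma quantile_le_iff (μ : Measure ℝ) [IsProbabilityMeasure μ] {u : ℝ} (hu : u ∈ Ioo (0:ℝ) 1)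
    (x : ℝ) : quantileFun μ u ≤ x ↔ u ≤ (μ (Set.Iic x)).toReal := by
  have hc : ∀ t, (μ (Set.Iic t)).toReal = ProbabilityTheory.cdf μ t := fun t => by
    rw [ProbabilityTheory.cdf_eq_real]; rfl
  unfold quantileFun
  simp only [hc]
  have hne : {t : ℝ | u ≤ ProbabilityTheory.cdf μ t}.Nonempty := by
    have h := (ProbabilityTheory.tendsto_cdf_atTop μ).eventually (lt_mem_nhds hu.2)
    obtain ⟨t, ht⟩ := h.exists
    exact ⟨t, ht.le⟩
  have hbd : BddBelow {t : ℝ | u ≤ ProbabilityTheory.cdf μ t} := by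
    have h := (ProbabilityTheory.tendsto_cdf_atBot μ).eventually (gt_mem_nhds hu.1)
    obtain ⟨t, ht⟩ := h.exists
    refine ⟨t, fun s hs => ?_⟩
    by_contra hlt
    push Not at hlt
    have := ProbabilityTheory.monotone_cdf μ hlt.le
    have hs' : u ≤ ProbabilityTheory.cdf μ s := hs
    linarith
  constructor
  · intro h
    have hgt : ∀ y, x < y → u ≤ ProbabilityTheory.cdf μ y := by
      intro y hy
      obtain ⟨s, hs, hsy⟩ := exists_lt_of_csInf_lt hne (lt_of_le_of_lt h hy)
      exact le_trans hs (ProbabilityTheory.monotone_cdf μ hsy.le)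
    have hr := (ProbabilityTheory.cdf μ).right_continuous x
    have ht : Filter.Tendsto (ProbabilityTheory.cdf μ) (nhdsWithin x (Ioi x))
        (nhds (ProbabilityTheory.cdf μ x)) :=
      hr.tendsto.mono_left (nhdsWithin_mono _ Ioi_subset_Ici_self)
    refine ge_of_tendsto ht ?_
    filter_upwards [self_mem_nhdsWithin] with y hy using hgt y hy
  · intro h
    exact csInf_le hbd h

lemma quantile_monoOn (μ : Measure ℝ) [IsProbabilityMeasure μ] :
    MonotoneOn (quantileFun μ) (Ioo (0:ℝ) 1) := by
  intro u hu v hv huv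
  rw [quantile_le_iff μ hu]
  exact huv.trans ((quantile_le_iff μ hv _).1 le_rfl)

lemma quantile_aemeas (μ : Measure ℝ) [IsProbabilityMeasure μ] :
    AEMeasurable (quantileFun μ) (volume.restrict (Ioo (0:ℝ) 1)) :=
  aemeasurable_restrict_of_monotoneOn measurableSet_Ioo (quantile_monoOn μ)

instance : IsProbabilityMeasure (volume.restrict (Ioo (0:ℝ) 1)) := ⟨by simp⟩

lemma map_quantile (μ : Measure ℝ) [IsProbabilityMeasure μ] :
    Measure.map (quantileFun μ) (volume.restrict (Ioo (0:ℝ) 1)) = μ := by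
  have : IsProbabilityMeasure
      (Measure.map (quantileFun μ) (volume.restrict (Ioo (0:ℝ) 1))) :=
    Measure.isProbabilityMeasure_map (quantile_aemeas μ)
  refine Measure.ext_of_Iic _ _ fun x => ?_
  rw [Measure.map_apply_of_aemeasurable (quantile_aemeas μ) measurableSet_Iic,
    Measure.restrict_apply₀' measurableSet_Ioo.nullMeasurableSet]
  have hle : (μ (Iic x)).toReal ≤ 1 := by
    have := prob_le_one (μ := μ) (s := Iic x)
    exact ENNReal.toReal_le_of_le_ofReal zero_le_one (by simpa using this)
  have h1 : quantileFun μ ⁻¹' Iic x ∩ Ioo 0 1 = Ioc 0 (μ (Iic x)).toReal ∩ Iio 1 := by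
    ext u
    simp only [mem_inter_iff, mem_preimage, mem_Iic, mem_Ioo, mem_Ioc, mem_Iio]
    constructor
    · rintro ⟨h, h0, h1⟩
      exact ⟨⟨h0, (quantile_le_iff μ ⟨h0, h1⟩ x).1 h⟩, h1⟩
    · rintro ⟨⟨h0, h⟩, h1⟩
      exact ⟨(quantile_le_iff μ ⟨h0, h1⟩ x).2 h, h0, h1⟩
  rw [h1]
  have h2 : volume (Ioc 0 (μ (Iic x)).toReal ∩ Iio 1) = volume (Ioc 0 (μ (Iic x)).toReal) := by
    apply le_antisymm (measure_mono inter_subset_left)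
    have : Ioo 0 (μ (Iic x)).toReal ⊆ Ioc 0 (μ (Iic x)).toReal ∩ Iio 1 :=
      fun u hu => ⟨⟨hu.1, hu.2.le⟩, lt_of_lt_of_le hu.2 hle⟩
    calc _ = volume (Ioo 0 (μ (Iic x)).toReal) := by simp
      _ ≤ _ := measure_mono this
  rw [h2, Real.volume_Ioc, sub_zero, ENNReal.ofReal_toReal (measure_ne_top _ _)]

/-- Splitting of a threshold for a comonotone family. -/
lemma exists_split {ι : Type*} [Fintype ι] (h : ι → ℝ → ℝ)
    (hm : ∀ i, MonotoneOn (h i) (Ioo (0:ℝ) 1)) (h0 : ∀ i, ∀ u ∈ Ioo (0:ℝ) 1, 0 ≤ h i u)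
    (t : ℝ) (ht : 0 ≤ t) :
    ∃ c : ι → ℝ, (∀ i, 0 ≤ c i) ∧ ∑ i, c i ≤ t ∧
      ∀ u ∈ Ioo (0:ℝ) 1, min (∑ i, h i u) t ≤ ∑ i, min (h i u) (c i) := by
  classical
  let A : Set ℝ := {u | u ∈ Ioo (0:ℝ) 1 ∧ ∑ i, h i u ≤ t}
  let B : Set ℝ := {u | u ∈ Ioo (0:ℝ) 1 ∧ t < ∑ i, h i u}
  let a : ι → ℝ := fun i => ⨆ u : A, h i u
  let b : ι → ℝ := fun i => ⨅ u : B, h i u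
  have hmA : ∀ i, Monotone (fun u : A => h i u) := fun i u v huv => hm i u.2.1 v.2.1 huv
  have hmB : ∀ i, Monotone (fun u : B => h i u) := fun i u v huv => hm i u.2.1 v.2.1 huv
  have hbA : ∀ i, BddAbove (range (fun u : A => h i u)) := by
    intro i
    refine ⟨t, ?_⟩
    rintro _ ⟨u, rfl⟩
    exact (Finset.single_le_sum (f := fun i => h i u) (fun j _ => h0 j u u.2.1)
      (Finset.mem_univ i)).trans u.2.2
  have hbB : ∀ i, BddBelow (range (fun u : B => h i u)) := by
    intro i
    refine ⟨0, ?_⟩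
    rintro _ ⟨u, rfl⟩
    exact h0 i u u.2.1
  have ha0 : ∀ i, 0 ≤ a i := fun i => Real.iSup_nonneg fun u => h0 i u u.2.1
  have hAa : ∀ i, ∀ u ∈ A, h i u ≤ a i := fun i u hu => le_ciSup (hbA i) (⟨u, hu⟩ : A)
  have hBb : ∀ i, ∀ u ∈ B, b i ≤ h i u := fun i u hu => ciInf_le (hbB i) (⟨u, hu⟩ : B)
  have hAB : ∀ u ∈ A, ∀ v ∈ B, u ≤ v := by
    intro u hu v hv
    by_contra hlt
    push Not at hlt
    have : ∑ i, h i v ≤ ∑ i, h i u :=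
      Finset.sum_le_sum fun i _ => hm i hv.1 hu.1 hlt.le
    have h1 := hu.2
    have h2 := hv.2
    linarith
  have hsa : ∑ i, a i ≤ t := by
    by_cases hA : Nonempty A
    · have : Filter.Tendsto (fun u : A => ∑ i, h i u) Filter.atTop (nhds (∑ i, a i)) :=
        tendsto_finsetSum _ fun i _ => tendsto_atTop_ciSup (hmA i) (hbA i)
      exact le_of_tendsto' this fun u => u.2.2
    · rw [not_nonempty_iff] at hA
      have : ∀ i, a i = 0 := fun i => Real.iSup_of_isEmpty _
      simpa [this] using ht
  by_cases hB : Nonempty B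
  · have hsb : t ≤ ∑ i, b i := by
      have : Filter.Tendsto (fun u : B => ∑ i, h i u) Filter.atBot (nhds (∑ i, b i)) :=
        tendsto_finsetSum _ fun i _ => tendsto_atBot_ciInf (hmB i) (hbB i)
      exact ge_of_tendsto' this fun u => u.2.2.le
    have hab : ∀ i, a i ≤ b i := by
      intro i
      refine le_ciInf fun v => ?_
      exact Real.iSup_le (fun u => hm i u.2.1 v.2.1 (hAB u u.2 v v.2)) (h0 i v v.2.1)
    obtain ⟨l, hl0, hl1, hl⟩ : ∃ l : ℝ, 0 ≤ l ∧ l ≤ 1 ∧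
        (1 - l) * ∑ i, a i + l * ∑ i, b i = t := by
      by_cases he : ∑ i, a i = ∑ i, b i
      · exact ⟨0, le_rfl, zero_le_one, by linarith⟩
      · have hlt : 0 < ∑ i, b i - ∑ i, a i := by
          have : ∑ i, a i < ∑ i, b i := lt_of_le_of_ne (by linarith) he
          linarith
        refine ⟨(t - ∑ i, a i) / (∑ i, b i - ∑ i, a i), div_nonneg (by linarith) hlt.le,
          (div_le_one hlt).2 (by linarith), ?_⟩
        field_simp
        ring
    have hca : ∀ i, a i ≤ (1 - l) * a i + l * b i := fun i => by nlinarith [hab i]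
    have hcb : ∀ i, (1 - l) * a i + l * b i ≤ b i := fun i => by nlinarith [hab i]
    have hsum : ∑ i, ((1 - l) * a i + l * b i) = t := by
      rw [Finset.sum_add_distrib, ← Finset.mul_sum, ← Finset.mul_sum, hl]
    refine ⟨fun i => (1 - l) * a i + l * b i, fun i => (ha0 i).trans (hca i), hsum.le, ?_⟩
    intro u hu
    rcases le_or_gt (∑ i, h i u) t with hut | hut
    · refine (min_le_left _ _).trans (Finset.sum_le_sum fun i _ => ?_)
      exact le_min le_rfl ((hAa i u ⟨hu, hut⟩).trans (hca i))
    · refine (min_le_right _ _).trans (hsum.ge.trans (Finset.sum_le_sum fun i _ => ?_))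
      exact le_min ((hcb i).trans (hBb i u ⟨hu, hut⟩)) le_rfl
  · refine ⟨a, ha0, hsa, fun u hu => ?_⟩
    rcases le_or_gt (∑ i, h i u) t with hut | hut
    · refine (min_le_left _ _).trans (Finset.sum_le_sum fun i _ => ?_)
      exact le_min le_rfl (hAa i u ⟨hu, hut⟩)
    · exact absurd ⟨⟨u, hu, hut⟩⟩ hB

lemma rpow_repr {α : ℝ} (h0 : 0 < α) (h1 : α < 1) {s : ℝ} (hs : 0 ≤ s) :
    ENNReal.ofReal (1 / α + 1 / (1 - α)) * ENNReal.ofReal (s ^ α) =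
      ∫⁻ t in Ioi (0:ℝ), ENNReal.ofReal (min s t) * ENNReal.ofReal (t ^ (α - 2)) := by
  have h1' : 0 < 1 - α := by linarith
  rcases hs.eq_or_lt with rfl | hs
  · rw [Real.zero_rpow h0.ne']
    symm
    simp only [ENNReal.ofReal_zero, mul_zero]
    rw [setLIntegral_congr_fun (g := fun _ => 0) measurableSet_Ioi]
    · simp
    · intro t ht
      have : min 0 t = 0 := min_eq_left (le_of_lt ht)
      simp [this]
  · rw [← Ioc_union_Ioi_eq_Ioi hs.le, lintegral_union measurableSet_Ioi
      (Set.Ioc_disjoint_Ioi le_rfl)]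
    have e1 : ∫⁻ t in Ioc 0 s, ENNReal.ofReal (min s t) * ENNReal.ofReal (t ^ (α - 2)) =
        ENNReal.ofReal (s ^ α / α) := by
      have hInteg : IntegrableOn (fun t : ℝ => t ^ (α - 1)) (Ioc 0 s) := by
        have := intervalIntegral.intervalIntegrable_rpow' (a := 0) (b := s) (r := α - 1)
          (by linarith)
        exact (intervalIntegrable_iff_integrableOn_Ioc_of_le hs.le).1 this
      have hv : ∫ t in Ioc 0 s, t ^ (α - 1) = s ^ α / α := by
        rw [← intervalIntegral.integral_of_le hs.le, integral_rpow (Or.inl (by linarith))]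
        simp [Real.zero_rpow h0.ne']
      rw [← hv, ofReal_integral_eq_lintegral_ofReal hInteg
        (by filter_upwards [ae_restrict_mem measurableSet_Ioc] with t ht
            exact Real.rpow_nonneg ht.1.le _)]
      refine setLIntegral_congr_fun measurableSet_Ioc fun t ht => ?_
      rw [min_eq_right ht.2, ← ENNReal.ofReal_mul ht.1.le]
      congr 1
      rw [show α - 1 = 1 + (α - 2) by ring, Real.rpow_add ht.1, Real.rpow_one]
    have e2 : ∫⁻ t in Ioi s, ENNReal.ofReal (min s t) * ENNReal.ofReal (t ^ (α - 2)) =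
        ENNReal.ofReal (s ^ α / (1 - α)) := by
      have hInteg : IntegrableOn (fun t : ℝ => t ^ (α - 2)) (Ioi s) :=
        integrableOn_Ioi_rpow_of_lt (by linarith) hs
      have hv : s * ∫ t in Ioi s, t ^ (α - 2) = s ^ α / (1 - α) := by
        rw [integral_Ioi_rpow_of_lt (by linarith) hs]
        rw [show α - 2 + 1 = α - 1 by ring, Real.rpow_sub_one hs.ne']
        have : α - 1 ≠ 0 := by linarith
        field_simp
        ring
      rw [← hv, ENNReal.ofReal_mul hs.le, ofReal_integral_eq_lintegral_ofReal hInteg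
        (by filter_upwards [ae_restrict_mem measurableSet_Ioi] with t ht
            exact Real.rpow_nonneg (hs.trans ht).le _),
        ← lintegral_const_mul' _ _ ENNReal.ofReal_ne_top]
      refine setLIntegral_congr_fun measurableSet_Ioi fun t ht => ?_
      rw [min_eq_left (le_of_lt ht)]
    have := Real.rpow_nonneg hs.le α
    rw [e1, e2, ← ENNReal.ofReal_mul (by positivity), ← ENNReal.ofReal_add (by positivity)
      (by positivity)]
    congr 1
    ring

/-- From `min` to concave powers. -/
lemma rpow_compare {Ω Ω' : Type} [MeasurableSpace Ω] [MeasurableSpace Ω'] (P : Measure Ω)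
    (N : Measure Ω') [SFinite P] [SFinite N] (f : Ω → ℝ) (g : Ω' → ℝ)
    (hf : AEMeasurable f P) (hg : AEMeasurable g N)
    (hf0 : ∀ᵐ x ∂P, 0 ≤ f x) (hg0 : ∀ᵐ x ∂N, 0 ≤ g x) {α : ℝ} (h0 : 0 < α) (h1 : α < 1)
    (H : ∀ t : ℝ, 0 < t → ∫⁻ x, ENNReal.ofReal (min (f x) t) ∂P ≤
      ∫⁻ x, ENNReal.ofReal (min (g x) t) ∂N) :
    ∫⁻ x, ENNReal.ofReal (f x ^ α) ∂P ≤ ∫⁻ x, ENNReal.ofReal (g x ^ α) ∂N := by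
  have key : ∀ {X : Type} [MeasurableSpace X] (M : Measure X) [SFinite M] (k : X → ℝ)
      (_ : AEMeasurable k M) (_ : ∀ᵐ x ∂M, 0 ≤ k x),
      ENNReal.ofReal (1 / α + 1 / (1 - α)) * ∫⁻ x, ENNReal.ofReal (k x ^ α) ∂M =
      ∫⁻ t in Ioi (0:ℝ), (∫⁻ x, ENNReal.ofReal (min (k x) t) ∂M) *
        ENNReal.ofReal (t ^ (α - 2)) := by
    intro X _ M _ k hk hk0
    rw [← lintegral_const_mul' _ _ ENNReal.ofReal_ne_top]
    have : ∀ᵐ x ∂M, ENNReal.ofReal (1 / α + 1 / (1 - α)) * ENNReal.ofReal (k x ^ α) =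
        ∫⁻ t in Ioi (0:ℝ), ENNReal.ofReal (min (k x) t) * ENNReal.ofReal (t ^ (α - 2)) := by
      filter_upwards [hk0] with x hx using rpow_repr h0 h1 hx
    rw [lintegral_congr_ae this, lintegral_lintegral_swap]
    · refine lintegral_congr fun t => ?_
      rw [lintegral_mul_const' _ _ ENNReal.ofReal_ne_top]
    · have hk' : AEMeasurable (fun p : X × ℝ => k p.1) (M.prod (volume.restrict (Ioi 0))) :=
        hk.comp_fst
      have h2 : Measurable (fun p : X × ℝ => p.2) := measurable_snd
      have h3 : Measurable (fun p : X × ℝ => p.2 ^ (α - 2)) := by fun_prop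
      exact ((hk'.min h2.aemeasurable).ennreal_ofReal).mul h3.ennreal_ofReal.aemeasurable
  have hK : ENNReal.ofReal (1 / α + 1 / (1 - α)) ≠ 0 := by
    have h1' : 0 < 1 - α := by linarith
    have : 0 < 1 / α + 1 / (1 - α) := by positivity
    simpa using this
  rw [← ENNReal.mul_le_mul_iff_right hK ENNReal.ofReal_ne_top, key P f hf hf0, key N g hg hg0]
  refine setLIntegral_mono' measurableSet_Ioi fun t ht => ?_
  gcongr
  exact H t ht

lemma absDiffLaw_eq (d : ℕ) (F G : Measure (Fin d → ℝ)) [IsProbabilityMeasure F]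
    [IsProbabilityMeasure G] (i : Fin d) :
    absDiffLaw d F G i = Measure.map (fun p => |p.1 i - p.2 i|) (F.prod G) := by
  unfold absDiffLaw
  rw [Measure.map_prod_map _ _ (measurable_pi_apply i) (measurable_pi_apply i),
    Measure.map_map (by fun_prop) (by fun_prop)]
  rfl

instance (d : ℕ) (F G : Measure (Fin d → ℝ)) [IsProbabilityMeasure F]
    [IsProbabilityMeasure G] (i : Fin d) : IsProbabilityMeasure (absDiffLaw d F G i) := by
  rw [absDiffLaw_eq]
  exact Measure.isProbabilityMeasure_map (by fun_prop)

lemma quantile_nonneg (d : ℕ) (F G : Measure (Fin d → ℝ)) [IsProbabilityMeasure F]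
    [IsProbabilityMeasure G] (i : Fin d) {u : ℝ} (hu : u ∈ Ioo (0:ℝ) 1) :
    0 ≤ quantileFun (absDiffLaw d F G i) u := by
  refine Real.sInf_nonneg fun t ht => ?_
  by_contra hlt
  push Not at hlt
  have : absDiffLaw d F G i (Iic t) = 0 := by
    rw [absDiffLaw_eq, Measure.map_apply (by fun_prop) measurableSet_Iic]
    convert measure_empty (μ := F.prod G)
    ext p
    simp only [mem_preimage, mem_Iic, mem_empty_iff_false, iff_false, not_le]
    exact hlt.trans_le (abs_nonneg _)
  have ht' : u ≤ (absDiffLaw d F G i (Iic t)).toReal := ht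
  rw [this] at ht'
  simp at ht'
  linarith [hu.1]

lemma lintegral_min (d : ℕ) (F G : Measure (Fin d → ℝ)) [IsProbabilityMeasure F]
    [IsProbabilityMeasure G] (i : Fin d) (c : ℝ) :
    ∫⁻ u in Ioo (0:ℝ) 1, ENNReal.ofReal (min (quantileFun (absDiffLaw d F G i) u ^ 2) c) =
    ∫⁻ p, ENNReal.ofReal (min ((p.1 i - p.2 i) ^ 2) c) ∂(F.prod G) := by
  have hf : Measurable (fun z : ℝ => ENNReal.ofReal (min (z ^ 2) c)) := by fun_prop
  have e1 : ∫⁻ z, ENNReal.ofReal (min (z ^ 2) c) ∂(absDiffLaw d F G i) =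
    ∫⁻ u in Ioo (0:ℝ) 1, ENNReal.ofReal (min (quantileFun (absDiffLaw d F G i) u ^ 2) c) := by
    conv_lhs => rw [← map_quantile (absDiffLaw d F G i)]
    rw [lintegral_map' hf.aemeasurable (quantile_aemeas _)]
  rw [← e1, absDiffLaw_eq, lintegral_map hf (by fun_prop)]
  simp only [sq_abs]

lemma min_compare (d : ℕ) (F G : Measure (Fin d → ℝ)) [IsProbabilityMeasure F]
    [IsProbabilityMeasure G] (t : ℝ) (ht : 0 < t) :
    ∫⁻ u in Ioo (0:ℝ) 1,
        ENNReal.ofReal (min (∑ i, quantileFun (absDiffLaw d F G i) u ^ 2) t) ≤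
    ∫⁻ p, ENNReal.ofReal (min (∑ i, (p.1 i - p.2 i) ^ 2) t) ∂(F.prod G) := by
  obtain ⟨c, hc0, hct, hc⟩ := exists_split
    (fun i u => quantileFun (absDiffLaw d F G i) u ^ 2)
    (fun i u hu v hv huv => pow_le_pow_left₀ (quantile_nonneg d F G i hu)
      (quantile_monoOn _ hu hv huv) 2)
    (fun i u _ => sq_nonneg _) t ht.le
  calc _ ≤ ∫⁻ u in Ioo (0:ℝ) 1, ∑ i,
        ENNReal.ofReal (min (quantileFun (absDiffLaw d F G i) u ^ 2) (c i)) := by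
        refine setLIntegral_mono' measurableSet_Ioo fun u hu => ?_
        rw [← ENNReal.ofReal_sum_of_nonneg fun i _ => le_min (sq_nonneg _) (hc0 i)]
        exact ENNReal.ofReal_le_ofReal (hc u hu)
    _ = ∑ i, ∫⁻ u in Ioo (0:ℝ) 1,
        ENNReal.ofReal (min (quantileFun (absDiffLaw d F G i) u ^ 2) (c i)) := by
        refine lintegral_finsetSum' _ fun i _ => ?_
        exact (((quantile_aemeas _).pow_const 2).min aemeasurable_const).ennreal_ofReal
    _ = ∑ i, ∫⁻ p, ENNReal.ofReal (min ((p.1 i - p.2 i) ^ 2) (c i)) ∂(F.prod G) :=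
        Finset.sum_congr rfl fun i _ => lintegral_min d F G i (c i)
    _ = ∫⁻ p, ∑ i, ENNReal.ofReal (min ((p.1 i - p.2 i) ^ 2) (c i)) ∂(F.prod G) := by
        rw [lintegral_finsetSum _ fun i _ => by fun_prop]
    _ ≤ _ := by
        refine lintegral_mono fun p => ?_
        simp only
        rw [← ENNReal.ofReal_sum_of_nonneg fun i _ => le_min (sq_nonneg _) (hc0 i)]
        refine ENNReal.ofReal_le_ofReal (le_min ?_ ?_)
        · exact Finset.sum_le_sum fun i _ => min_le_left _ _
        · exact (Finset.sum_le_sum fun i _ => min_le_right _ _).trans hct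

lemma euclNorm_eq {d : ℕ} (x : Fin d → ℝ) : euclNorm x = ‖WithLp.toLp 2 x‖ := by
  rw [EuclideanSpace.norm_eq]
  simp [euclNorm]

lemma dist2_le {d : ℕ} (x y : Fin d → ℝ) : dist2 x y ≤ euclNorm x + euclNorm y := by
  have : dist2 x y = euclNorm (x - y) := rfl
  rw [this, euclNorm_eq, euclNorm_eq, euclNorm_eq, WithLp.toLp_sub]
  exact norm_sub_le _ _

lemma dist2_meas {d : ℕ} : Measurable (fun p : (Fin d → ℝ) × (Fin d → ℝ) => dist2 p.1 p.2) := by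
  unfold dist2
  fun_prop

lemma dist2_integrable (d : ℕ) (β : ℝ) (hβ0 : 0 < β)
    (F G : Measure (Fin d → ℝ)) [IsProbabilityMeasure F] [IsProbabilityMeasure G]
    (hF : Integrable (fun x => euclNorm x ^ β) F)
    (hG : Integrable (fun x => euclNorm x ^ β) G) :
    Integrable (fun p : (Fin d → ℝ) × (Fin d → ℝ) => dist2 p.1 p.2 ^ β) (F.prod G) := by
  have hb := ((hF.comp_fst G).add (hG.comp_snd F)).const_mul (2 ^ β)
  refine hb.mono' (dist2_meas.pow_const β).aestronglyMeasurable ?_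
  refine Filter.Eventually.of_forall fun p => ?_
  have n1 : 0 ≤ euclNorm p.1 := Real.sqrt_nonneg _
  have n2 : 0 ≤ euclNorm p.2 := Real.sqrt_nonneg _
  have n3 : 0 ≤ dist2 p.1 p.2 := Real.sqrt_nonneg _
  have m1 := Real.rpow_nonneg n1 β
  have m2 := Real.rpow_nonneg n2 β
  rw [Real.norm_of_nonneg (Real.rpow_nonneg n3 _)]
  have h1 : dist2 p.1 p.2 ≤ 2 * max (euclNorm p.1) (euclNorm p.2) := by
    have := dist2_le p.1 p.2
    linarith [le_max_left (euclNorm p.1) (euclNorm p.2),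
      le_max_right (euclNorm p.1) (euclNorm p.2)]
  calc dist2 p.1 p.2 ^ β ≤ (2 * max (euclNorm p.1) (euclNorm p.2)) ^ β :=
        Real.rpow_le_rpow n3 h1 hβ0.le
    _ = 2 ^ β * (max (euclNorm p.1) (euclNorm p.2)) ^ β :=
        Real.mul_rpow (by norm_num) (le_max_of_le_left n1)
    _ ≤ 2 ^ β * (euclNorm p.1 ^ β + euclNorm p.2 ^ β) := by
        gcongr
        rcases max_choice (euclNorm p.1) (euclNorm p.2) with h | h <;> rw [h] <;> linarith
    _ = _ := by simp

end QAux

/-- lower bound `S_β(F,G) ≥ ∫₀¹ (Σᵢ Qᵢ(u)²)^{β/2} du`, where `Qᵢ` is the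
quantile function of the law of `|Xᵢ - Yᵢ|` for independent `Xᵢ ∼ Fᵢ`, `Yᵢ ∼ Gᵢ`. -/
theorem stmt1 (d : ℕ) (β : ℝ) (hβ0 : 0 < β) (hβ2 : β < 2)
    (F G : Measure (Fin d → ℝ)) [IsProbabilityMeasure F] [IsProbabilityMeasure G]
    (hF : Integrable (fun x => euclNorm x ^ β) F)
    (hG : Integrable (fun x => euclNorm x ^ β) G) :
    Sb d β F G ≥
      ∫ u in Set.Ioo (0:ℝ) 1, (∑ i, (quantileFun (absDiffLaw d F G i) u) ^ 2) ^ (β / 2) := by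
  have hInteg := QAux.dist2_integrable d β hβ0 F G hF hG
  have hpow : ∀ p : (Fin d → ℝ) × (Fin d → ℝ),
      dist2 p.1 p.2 ^ β = (∑ i, (p.1 i - p.2 i) ^ 2) ^ (β / 2) := by
    intro p
    have : 0 ≤ ∑ i, (p.1 i - p.2 i) ^ 2 := Finset.sum_nonneg fun i _ => sq_nonneg _
    rw [dist2, Real.sqrt_eq_rpow, ← Real.rpow_mul this]
    congr 1
    ring
  have hSb : Sb d β F G = ∫ p, dist2 p.1 p.2 ^ β ∂(F.prod G) := by
    rw [integral_prod _ hInteg]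
    rfl
  have hS : ∀ u, 0 ≤ ∑ i, (quantileFun (absDiffLaw d F G i) u) ^ 2 := fun u =>
    Finset.sum_nonneg fun i _ => sq_nonneg _
  have hSm : AEMeasurable (fun u => ∑ i, (quantileFun (absDiffLaw d F G i) u) ^ 2)
      (volume.restrict (Ioo (0:ℝ) 1)) :=
    Finset.aemeasurable_fun_sum _ fun i _ => (QAux.quantile_aemeas _).pow_const 2
  have hmain := QAux.rpow_compare (volume.restrict (Ioo (0:ℝ) 1)) (F.prod G)
    (fun u => ∑ i, (quantileFun (absDiffLaw d F G i) u) ^ 2)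
    (fun p => ∑ i, (p.1 i - p.2 i) ^ 2) hSm (by fun_prop)
    (Filter.Eventually.of_forall hS)
    (Filter.Eventually.of_forall fun p => Finset.sum_nonneg fun i _ => sq_nonneg _)
    (α := β / 2) (by linarith) (by linarith) (QAux.min_compare d F G)
  rw [ge_iff_le, hSb]
  simp only [hpow] at hInteg ⊢
  have hnn : ∀ p : (Fin d → ℝ) × (Fin d → ℝ), 0 ≤ (∑ i, (p.1 i - p.2 i) ^ 2) ^ (β / 2) :=
    fun p => Real.rpow_nonneg (Finset.sum_nonneg fun i _ => sq_nonneg _) _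
  rw [integral_eq_lintegral_of_nonneg_ae
      (Filter.Eventually.of_forall fun u => Real.rpow_nonneg (hS u) _)
      (hSm.pow_const _).aestronglyMeasurable,
    integral_eq_lintegral_of_nonneg_ae (Filter.Eventually.of_forall hnn)
      hInteg.aestronglyMeasurable]
  refine ENNReal.toReal_mono ?_ hmain
  rw [← ofReal_integral_eq_lintegral_ofReal hInteg (Filter.Eventually.of_forall hnn)]
  exact ENNReal.ofReal_ne_top
end

section
/- For every copula C on [0,1]², S(C,C) ≤ π/6, where S(C,C) = ∫∫ ‖x−y‖₂ C(dx) C(dy). -/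
open MeasureTheory Set

/-- `S(F,G) = ∫∫ ‖x-y‖₂ F(dx) G(dy)`. -/
noncomputable def S (d : ℕ) (F G : Measure (Fin d → ℝ)) : ℝ :=
  ∫ x, ∫ y, dist2 x y ∂G ∂F

/-- The uniform (Lebesgue) measure on `[0,1]`. -/
noncomputable def uniform01 : Measure ℝ := volume.restrict (Set.Icc 0 1)

/-- A copula: a probability measure on `[0,1]^d` whose one-dimensional coordinate
marginals all equal the uniform measure on `[0,1]`. -/
def IsCopula (d : ℕ) (C : Measure (Fin d → ℝ)) : Prop :=
  IsProbabilityMeasure C ∧ ∀ i : Fin d, Measure.map (fun x => x i) C = uniform01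

/-- Clamped linear function. -/
noncomputable def kk (u : ℝ) : ℝ := max (-1) (min 1 (2 * u))

noncomputable def hh (s u : ℝ) : ℝ := ({x | x ≤ s} : Set ℝ).indicator (fun _ => (1 : ℝ)) u

noncomputable def aa (s u : ℝ) : ℝ := hh s u - (1 - kk u) / 2

lemma kk_cont : Continuous kk := by unfold kk; fun_prop

lemma kk_bd (u : ℝ) : |kk u| ≤ 1 := by
  unfold kk
  rw [abs_le]
  exact ⟨le_max_left _ _, max_le (by norm_num) (min_le_left _ _)⟩

lemma hh_cases (s u : ℝ) : (u ≤ s ∧ hh s u = 1) ∨ (s < u ∧ hh s u = 0) := by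
  unfold hh
  rcases le_or_gt u s with h | h
  · left; exact ⟨h, by simp [h]⟩
  · right; exact ⟨h, by simp [h]⟩

lemma aa_bd (s u : ℝ) : |aa s u| ≤ 1 := by
  have h1 := abs_le.1 (kk_bd u)
  unfold aa
  rw [abs_le]
  rcases hh_cases s u with ⟨_, h⟩ | ⟨_, h⟩ <;> rw [h] <;> constructor <;> linarith [h1.1, h1.2]

lemma aa_meas : Measurable (fun p : ℝ × ℝ => aa p.1 p.2) := by
  have : (fun p : ℝ × ℝ => aa p.1 p.2) = fun p : ℝ × ℝ =>
      ({q : ℝ × ℝ | q.2 ≤ q.1}).indicator (fun _ => (1 : ℝ)) p - (1 - kk p.2) / 2 := by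
    funext p
    simp [aa, hh, Set.indicator]
  rw [this]
  have hk := kk_cont.measurable
  refine Measurable.sub ?_ (by fun_prop)
  exact measurable_const.indicator (measurableSet_le measurable_snd measurable_fst)

lemma int_two_mul (a b : ℝ) : ∫ u in a..b, 2 * u = b ^ 2 - a ^ 2 := by
  rw [intervalIntegral.integral_const_mul, integral_id]; ring

lemma P_zero : ∫ u in (-1 : ℝ)..0, kk u = -3 / 4 := by
  have hi : ∀ a b, IntervalIntegrable kk volume a b := fun a b => kk_cont.intervalIntegrable a b
  rw [← intervalIntegral.integral_add_adjacent_intervals (hi (-1) (-1/2)) (hi (-1/2) 0)]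
  have h1 : ∫ u in (-1 : ℝ)..(-1/2), kk u = ∫ u in (-1 : ℝ)..(-1/2), (-1 : ℝ) := by
    apply intervalIntegral.integral_congr
    intro u hu
    rw [uIcc_of_le (by norm_num)] at hu
    simp only [kk]
    exact max_eq_left (le_trans (min_le_right _ _) (by linarith [hu.2]))
  have h2 : ∫ u in (-1/2 : ℝ)..0, kk u = ∫ u in (-1/2 : ℝ)..0, 2 * u := by
    apply intervalIntegral.integral_congr
    intro u hu
    rw [uIcc_of_le (by norm_num)] at hu
    simp only [kk]
    rw [min_eq_right (by linarith [hu.2]), max_eq_right (by linarith [hu.1])]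
  rw [h1, h2, int_two_mul, intervalIntegral.integral_const]
  norm_num

lemma P_le (t : ℝ) : ∫ u in (-1 : ℝ)..t, kk u ≤ t ^ 2 - 3 / 4 := by
  have hi : ∀ a b, IntervalIntegrable kk volume a b := fun a b => kk_cont.intervalIntegrable a b
  rw [← intervalIntegral.integral_add_adjacent_intervals (hi (-1) 0) (hi 0 t), P_zero]
  have hl : ∀ a b : ℝ, IntervalIntegrable (fun u : ℝ => 2 * u) volume a b :=
    fun a b => (by fun_prop : Continuous fun u : ℝ => 2 * u).intervalIntegrable a b
  have key : ∫ u in (0 : ℝ)..t, kk u ≤ ∫ u in (0 : ℝ)..t, 2 * u := by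
    rcases le_total 0 t with h | h
    · apply intervalIntegral.integral_mono_on h (hi _ _) (hl _ _)
      intro u hu
      exact max_le (by linarith [hu.1]) (min_le_right _ _)
    · rw [intervalIntegral.integral_symm t 0, intervalIntegral.integral_symm t 0]
      apply neg_le_neg
      apply intervalIntegral.integral_mono_on h (hl _ _) (hi _ _)
      intro u hu
      exact le_max_of_le_right (le_min (by linarith [hu.2]) le_rfl)
  rw [int_two_mul] at key
  linarith

lemma G_sq : ∫ u in (-1 : ℝ)..1, ((1 - kk u) / 2) ^ 2 = 5 / 6 := by
  have hc : Continuous (fun u => ((1 - kk u) / 2) ^ 2) := by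
    have := kk_cont
    fun_prop
  have hi : ∀ a b, IntervalIntegrable (fun u => ((1 - kk u) / 2) ^ 2) volume a b :=
    fun a b => hc.intervalIntegrable a b
  rw [← intervalIntegral.integral_add_adjacent_intervals (hi (-1) (-1/2)) (hi (-1/2) 1),
    ← intervalIntegral.integral_add_adjacent_intervals (hi (-1/2) (1/2)) (hi (1/2) 1)]
  have h1 : ∫ u in (-1 : ℝ)..(-1/2), ((1 - kk u) / 2) ^ 2 = ∫ u in (-1 : ℝ)..(-1/2), (1 : ℝ) := by
    apply intervalIntegral.integral_congr
    intro u hu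
    rw [uIcc_of_le (by norm_num)] at hu
    simp only [kk]
    rw [max_eq_left (le_trans (min_le_right _ _) (by linarith [hu.2]))]
    norm_num
  have h2 : ∫ u in (-1/2 : ℝ)..(1/2), ((1 - kk u) / 2) ^ 2
      = ∫ u in (-1/2 : ℝ)..(1/2), (1/4 - u + u ^ 2) := by
    apply intervalIntegral.integral_congr
    intro u hu
    rw [uIcc_of_le (by norm_num)] at hu
    simp only [kk]
    rw [min_eq_right (by linarith [hu.2]), max_eq_right (by linarith [hu.1])]
    ring
  have h3 : ∫ u in (1/2 : ℝ)..1, ((1 - kk u) / 2) ^ 2 = ∫ u in (1/2 : ℝ)..1, (0 : ℝ) := by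
    apply intervalIntegral.integral_congr
    intro u hu
    rw [uIcc_of_le (by norm_num)] at hu
    simp only [kk]
    rw [min_eq_left (by linarith [hu.1]), max_eq_right (by norm_num)]
    norm_num
  rw [h1, h2, h3, intervalIntegral.integral_add, intervalIntegral.integral_sub]
  · simp only [integral_id, intervalIntegral.integral_const, integral_pow]
    norm_num
  all_goals exact Continuous.intervalIntegrable (by fun_prop) _ _

lemma hh_int (s : ℝ) (hs : |s| ≤ 1) (w : ℝ → ℝ) :
    ∫ u in (-1 : ℝ)..1, hh s u * w u = ∫ u in (-1 : ℝ)..s, w u := by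
  rw [← intervalIntegral.integral_indicator (a₂ := s) (a₃ := 1) (abs_le.1 hs)]
  apply intervalIntegral.integral_congr
  intro u _
  simp only [hh, Set.indicator]
  split_ifs <;> simp

lemma hh_ii (s : ℝ) (w : ℝ → ℝ) (hw : Continuous w) :
    IntervalIntegrable (fun u => hh s u * w u) volume (-1) 1 := by
  have h := hw.intervalIntegrable (μ := volume) (-1) 1
  rw [intervalIntegrable_iff] at h ⊢
  have h2 := h.indicator (measurableSet_Iic (a := s))
  refine h2.congr (Filter.Eventually.of_forall fun u => ?_)
  simp only [hh, Set.indicator, mem_Iic, mem_ofPred_eq]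
  split_ifs <;> simp

lemma oneD_aux (s t : ℝ) (hs : |s| ≤ 1) (ht : |t| ≤ 1) (hst : s ≤ t) :
    (t - s) + 2 * ∫ u in (-1 : ℝ)..1, aa s u * aa t u ≤ s ^ 2 + t ^ 2 + 1 / 6 := by
  have hkc := kk_cont
  have e : ∀ u, aa s u * aa t u = hh s u * ((1 + kk u) / 2) - hh t u * ((1 - kk u) / 2)
      + ((1 - kk u) / 2) ^ 2 := by
    intro u
    unfold aa
    rcases hh_cases s u with ⟨h1, h⟩ | ⟨h1, h⟩ <;> rcases hh_cases t u with ⟨h2, h'⟩ | ⟨h2, h'⟩ <;>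
      rw [h, h']
    · ring
    · linarith
    · ring
    · ring
  have c1 : Continuous fun u => (1 + kk u) / 2 := by fun_prop
  have c2 : Continuous fun u => (1 - kk u) / 2 := by fun_prop
  have c3 : Continuous fun u => ((1 - kk u) / 2) ^ 2 := by fun_prop
  simp_rw [e]
  rw [intervalIntegral.integral_add ((hh_ii s _ c1).sub (hh_ii t _ c2)) (c3.intervalIntegrable _ _),
    intervalIntegral.integral_sub (hh_ii s _ c1) (hh_ii t _ c2), hh_int s hs, hh_int t ht, G_sq]
  have i1 : ∫ u in (-1 : ℝ)..s, (1 + kk u) / 2 = ((s + 1) + ∫ u in (-1 : ℝ)..s, kk u) / 2 := by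
    rw [intervalIntegral.integral_div, intervalIntegral.integral_add
      (by simp) (hkc.intervalIntegrable _ _)]
    simp
  have i2 : ∫ u in (-1 : ℝ)..t, (1 - kk u) / 2 = ((t + 1) - ∫ u in (-1 : ℝ)..t, kk u) / 2 := by
    rw [intervalIntegral.integral_div, intervalIntegral.integral_sub
      (by simp) (hkc.intervalIntegrable _ _)]
    simp
  rw [i1, i2]
  linarith [P_le s, P_le t]

lemma oneD (s t : ℝ) (hs : |s| ≤ 1) (ht : |t| ≤ 1) :
    |s - t| + 2 * ∫ u in (-1 : ℝ)..1, aa s u * aa t u ≤ s ^ 2 + t ^ 2 + 1 / 6 := by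
  rcases le_total s t with h | h
  · rw [abs_sub_comm, abs_of_nonneg (by linarith)]
    exact oneD_aux s t hs ht h
  · rw [abs_of_nonneg (by linarith)]
    have := oneD_aux t s ht hs h
    simp_rw [mul_comm (aa s _)]
    linarith

/-- Crofton formula in the plane. -/
lemma crofton (a b : ℝ) :
    ∫ θ in (0 : ℝ)..Real.pi, |a * Real.cos θ + b * Real.sin θ| = 2 * Real.sqrt (a ^ 2 + b ^ 2) := by
  set z : ℂ := ⟨a, b⟩ with hz
  have hn : ‖z‖ = Real.sqrt (a ^ 2 + b ^ 2) := by
    rw [Complex.norm_def, Complex.normSq_mk]; ring_nf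
  have ha : a = ‖z‖ * Real.cos z.arg := (Complex.norm_mul_cos_arg z).symm
  have hb : b = ‖z‖ * Real.sin z.arg := (Complex.norm_mul_sin_arg z).symm
  have e : ∀ θ, |a * Real.cos θ + b * Real.sin θ| = ‖z‖ * |Real.cos (θ - z.arg)| := by
    intro θ
    have e1 : a * Real.cos θ + b * Real.sin θ = ‖z‖ * Real.cos (θ - z.arg) := by
      rw [Real.cos_sub]
      linear_combination Real.cos θ * ha + Real.sin θ * hb
    rw [e1, abs_mul, abs_of_nonneg (norm_nonneg z)]
  simp_rw [e]
  rw [intervalIntegral.integral_const_mul, ← hn,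
    intervalIntegral.integral_comp_sub_right (fun x => |Real.cos x|)]
  have hp : Function.Periodic (fun x => |Real.cos x|) Real.pi := by
    intro x; simp [Real.cos_add_pi]
  have h1 := hp.intervalIntegral_add_eq (0 - z.arg) (-(Real.pi / 2))
  rw [show 0 - z.arg + Real.pi = Real.pi - z.arg by ring,
    show -(Real.pi / 2) + Real.pi = Real.pi / 2 by ring] at h1
  rw [h1]
  have h2 : ∫ x in -(Real.pi / 2)..(Real.pi / 2), |Real.cos x|
      = ∫ x in -(Real.pi / 2)..(Real.pi / 2), Real.cos x := by
    apply intervalIntegral.integral_congr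
    intro x hx
    rw [uIcc_of_le (by linarith [Real.pi_pos])] at hx
    exact abs_of_nonneg (Real.cos_nonneg_of_mem_Icc hx)
  rw [h2, integral_cos]
  simp
  ring

noncomputable def TT (x : Fin 2 → ℝ) (θ : ℝ) : ℝ :=
  (x 0 - 1 / 2) * Real.cos θ + (x 1 - 1 / 2) * Real.sin θ

noncomputable def bb (x : Fin 2 → ℝ) (w : ℝ × ℝ) : ℝ := aa (TT x w.1) w.2

noncomputable def rho : Measure (ℝ × ℝ) :=
  (volume.restrict (Ioc 0 Real.pi)).prod (volume.restrict (Ioc (-1) 1))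

instance : IsFiniteMeasure rho := by unfold rho; infer_instance

lemma bb_meas : Measurable (fun p : (Fin 2 → ℝ) × (ℝ × ℝ) => bb p.1 p.2) := by
  unfold bb TT
  refine aa_meas.comp (g := fun p : ℝ × ℝ => aa p.1 p.2)
    (f := fun p : (Fin 2 → ℝ) × (ℝ × ℝ) => ((p.1 0 - 1 / 2) * Real.cos p.2.1 + (p.1 1 - 1 / 2) * Real.sin p.2.1, p.2.2)) ?_
  fun_prop

lemma TT_sq (x : Fin 2 → ℝ) :
    ∫ θ in (0 : ℝ)..Real.pi, TT x θ ^ 2 = Real.pi / 2 * ((x 0 - 1 / 2) ^ 2 + (x 1 - 1 / 2) ^ 2) := by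
  have e : ∀ θ, TT x θ ^ 2 = (x 0 - 1 / 2) ^ 2 * Real.cos θ ^ 2
      + (x 1 - 1 / 2) ^ 2 * Real.sin θ ^ 2
      + 2 * (x 0 - 1 / 2) * (x 1 - 1 / 2) * (Real.sin θ * Real.cos θ) := by
    intro θ; unfold TT; ring
  simp_rw [e]
  rw [intervalIntegral.integral_add, intervalIntegral.integral_add]
  · simp only [intervalIntegral.integral_const_mul, integral_sin_sq, integral_cos_sq,
      integral_sin_mul_cos₁]
    simp
    ring
  all_goals exact Continuous.intervalIntegrable (by fun_prop) _ _

lemma TT_bd (x : Fin 2 → ℝ) (h0 : x 0 ∈ Icc (0 : ℝ) 1) (h1 : x 1 ∈ Icc (0 : ℝ) 1) (θ : ℝ) :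
    |TT x θ| ≤ 1 := by
  unfold TT
  have a0 : |x 0 - 1 / 2| ≤ 1 / 2 := by rw [abs_le]; constructor <;> linarith [h0.1, h0.2]
  have a1 : |x 1 - 1 / 2| ≤ 1 / 2 := by rw [abs_le]; constructor <;> linarith [h1.1, h1.2]
  have m0 := mul_le_mul a0 (Real.abs_cos_le_one θ) (abs_nonneg _) (by norm_num)
  have m1 := mul_le_mul a1 (Real.abs_sin_le_one θ) (abs_nonneg _) (by norm_num)
  rw [← abs_mul] at m0 m1
  linarith [abs_add_le ((x 0 - 1 / 2) * Real.cos θ) ((x 1 - 1 / 2) * Real.sin θ)]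

lemma bb_bd (x : Fin 2 → ℝ) (w : ℝ × ℝ) : |bb x w| ≤ 1 := aa_bd _ _

lemma bb_mul_bd (x y : Fin 2 → ℝ) (w : ℝ × ℝ) : ‖bb x w * bb y w‖ ≤ 1 := by
  rw [Real.norm_eq_abs, abs_mul]
  exact mul_le_one₀ (bb_bd _ _) (abs_nonneg _) (bb_bd _ _)

lemma bb_mul_int (x y : Fin 2 → ℝ) : Integrable (fun w => bb x w * bb y w) rho := by
  apply Integrable.of_bound (C := 1)
  · have h1 : Measurable (bb x) := bb_meas.comp (measurable_prodMk_left (x := x))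
    have h2 : Measurable (bb y) := bb_meas.comp (measurable_prodMk_left (x := y))
    exact (h1.mul h2).aestronglyMeasurable
  · exact Filter.Eventually.of_forall fun w => bb_mul_bd x y w

noncomputable def KK (x y : Fin 2 → ℝ) : ℝ := ∫ w, bb x w * bb y w ∂rho

noncomputable def qq (x : Fin 2 → ℝ) : ℝ :=
  Real.pi / 4 * ((x 0 - 1 / 2) ^ 2 + (x 1 - 1 / 2) ^ 2)

lemma pointwise (x y : Fin 2 → ℝ) (h0 : x 0 ∈ Icc (0 : ℝ) 1) (h1 : x 1 ∈ Icc (0 : ℝ) 1)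
    (k0 : y 0 ∈ Icc (0 : ℝ) 1) (k1 : y 1 ∈ Icc (0 : ℝ) 1) :
    dist2 x y ≤ (qq x + qq y + Real.pi / 12) - KK x y := by
  have hc := crofton (x 0 - y 0) (x 1 - y 1)
  have hd : dist2 x y = Real.sqrt ((x 0 - y 0) ^ 2 + (x 1 - y 1) ^ 2) := by
    unfold dist2; rw [Fin.sum_univ_two]
  rw [← hd] at hc
  have hbi : Integrable (fun w : ℝ × ℝ => bb x w * bb y w)
      ((volume.restrict (Ioc 0 Real.pi)).prod (volume.restrict (Ioc (-1) 1))) := bb_mul_int x y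
  have hK : KK x y = ∫ θ in (0 : ℝ)..Real.pi, ∫ u in (-1 : ℝ)..1, aa (TT x θ) u * aa (TT y θ) u := by
    unfold KK rho
    rw [integral_prod _ hbi, intervalIntegral.integral_of_le Real.pi_pos.le]
    simp_rw [intervalIntegral.integral_of_le (show (-1 : ℝ) ≤ 1 by norm_num)]
    rfl
  have hKi : IntervalIntegrable
      (fun θ => ∫ u in (-1 : ℝ)..1, aa (TT x θ) u * aa (TT y θ) u) volume 0 Real.pi := by
    rw [intervalIntegrable_iff_integrableOn_Ioc_of_le Real.pi_pos.le]
    have := hbi.integral_prod_left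
    simp_rw [intervalIntegral.integral_of_le (show (-1 : ℝ) ≤ 1 by norm_num)]
    exact this
  have cT : ∀ z, Continuous (TT z) := fun z => by unfold TT; fun_prop
  have cx := cT x
  have cy := cT y
  have hm : ∫ θ in (0 : ℝ)..Real.pi, (|(x 0 - y 0) * Real.cos θ + (x 1 - y 1) * Real.sin θ|
        + 2 * ∫ u in (-1 : ℝ)..1, aa (TT x θ) u * aa (TT y θ) u)
      ≤ ∫ θ in (0 : ℝ)..Real.pi, (TT x θ ^ 2 + TT y θ ^ 2 + 1 / 6) := by
    apply intervalIntegral.integral_mono_on Real.pi_pos.le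
    · exact (Continuous.intervalIntegrable (by fun_prop) _ _).add (hKi.const_mul 2)
    · exact Continuous.intervalIntegrable (by fun_prop) _ _
    · intro θ _
      have := oneD (TT x θ) (TT y θ) (TT_bd x h0 h1 θ) (TT_bd y k0 k1 θ)
      have e : TT x θ - TT y θ = (x 0 - y 0) * Real.cos θ + (x 1 - y 1) * Real.sin θ := by
        unfold TT; ring
      rwa [e] at this
  rw [intervalIntegral.integral_add (Continuous.intervalIntegrable (by fun_prop) _ _)
    (hKi.const_mul 2), intervalIntegral.integral_const_mul, ← hK, hc,
    intervalIntegral.integral_add (Continuous.intervalIntegrable (by fun_prop) _ _)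
      (Continuous.intervalIntegrable (by fun_prop) _ _),
    intervalIntegral.integral_add (Continuous.intervalIntegrable (by fun_prop) _ _)
      (Continuous.intervalIntegrable (by fun_prop) _ _), TT_sq, TT_sq] at hm
  simp only [intervalIntegral.integral_const, smul_eq_mul] at hm
  unfold qq
  linarith

section
variable (C : Measure (Fin 2 → ℝ)) [IsProbabilityMeasure C]

lemma KK_bd (x y : Fin 2 → ℝ) : ‖KK x y‖ ≤ 1 * rho.real univ :=
  norm_integral_le_of_norm_le_const (Filter.Eventually.of_forall fun w => bb_mul_bd x y w)

lemma inner_swap (x : Fin 2 → ℝ) :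
    ∫ y, KK x y ∂C = ∫ w, bb x w * (∫ y, bb y w ∂C) ∂rho := by
  unfold KK
  rw [integral_integral_swap]
  · simp_rw [integral_const_mul]
  · apply Integrable.of_bound (C := 1)
    · have h1 : Measurable (bb x) := bb_meas.comp (measurable_prodMk_left (x := x))
      exact ((h1.comp measurable_snd).mul bb_meas).aestronglyMeasurable
    · exact Filter.Eventually.of_forall fun w => bb_mul_bd x w.1 w.2

lemma mm_meas : Measurable (fun w => ∫ y, bb y w ∂C) := by
  have : StronglyMeasurable (fun p : (ℝ × ℝ) × (Fin 2 → ℝ) => bb p.2 p.1) :=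
    (bb_meas.comp measurable_swap).stronglyMeasurable
  exact this.integral_prod_right.measurable

lemma mm_bd (w : ℝ × ℝ) : ‖∫ y, bb y w ∂C‖ ≤ 1 := by
  have := norm_integral_le_of_norm_le_const (μ := C) (f := fun y => bb y w) (C := 1)
    (Filter.Eventually.of_forall fun y => bb_bd y w)
  simpa using this

lemma pair_int : Integrable (fun p : (Fin 2 → ℝ) × (ℝ × ℝ) => bb p.1 p.2 * (∫ y, bb y p.2 ∂C))
    (C.prod rho) := by
  apply Integrable.of_bound (C := 1)
  · exact (bb_meas.mul ((mm_meas C).comp measurable_snd)).aestronglyMeasurable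
  · refine Filter.Eventually.of_forall fun w => ?_
    rw [norm_mul]
    exact mul_le_one₀ (bb_bd _ _) (norm_nonneg _) (mm_bd C _)

lemma KK_int_int : Integrable (fun x => ∫ y, KK x y ∂C) C := by
  simp_rw [inner_swap]
  exact (pair_int C).integral_prod_left

lemma KK_int (x : Fin 2 → ℝ) : Integrable (fun y => KK x y) C := by
  have h1 : Measurable (bb x) := bb_meas.comp (measurable_prodMk_left (x := x))
  have : StronglyMeasurable (fun p : (Fin 2 → ℝ) × (ℝ × ℝ) => bb x p.2 * bb p.1 p.2) :=
    ((h1.comp measurable_snd).mul bb_meas).stronglyMeasurable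
  apply Integrable.of_bound (C := 1 * rho.real univ)
  · exact (this.integral_prod_right (ν := rho)).aestronglyMeasurable
  · exact Filter.Eventually.of_forall fun y => KK_bd x y

lemma KK_psd : 0 ≤ ∫ x, ∫ y, KK x y ∂C ∂C := by
  simp_rw [inner_swap]
  rw [integral_integral_swap (pair_int C)]
  simp_rw [integral_mul_const]
  exact integral_nonneg fun w => mul_self_nonneg _

end

lemma marg (C : Measure (Fin 2 → ℝ)) (hC : IsCopula 2 C) (i : Fin 2) :
    (∀ᵐ x ∂C, x i ∈ Icc (0 : ℝ) 1) ∧ Integrable (fun x : Fin 2 → ℝ => (x i - 1 / 2) ^ 2) C ∧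
      ∫ x, (x i - 1 / 2) ^ 2 ∂C = 1 / 12 := by
  have hm := hC.2 i
  have hmeas : AEMeasurable (fun x : Fin 2 → ℝ => x i) C := (measurable_pi_apply i).aemeasurable
  have hf : Continuous (fun t : ℝ => (t - 1 / 2) ^ 2) := by fun_prop
  refine ⟨?_, ?_, ?_⟩
  · have : ∀ᵐ t ∂(Measure.map (fun x : Fin 2 → ℝ => x i) C), t ∈ Icc (0 : ℝ) 1 := by
      rw [hm]; exact ae_restrict_mem measurableSet_Icc
    exact ae_of_ae_map hmeas this
  · have : Integrable (fun t : ℝ => (t - 1 / 2) ^ 2) (Measure.map (fun x : Fin 2 → ℝ => x i) C) := by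
      rw [hm]; exact hf.integrableOn_Icc
    exact this.comp_aemeasurable hmeas
  · have := integral_map hmeas (f := fun t : ℝ => (t - 1 / 2) ^ 2) hf.aestronglyMeasurable
    rw [← this, hm]
    unfold uniform01
    rw [integral_Icc_eq_integral_Ioc, ← intervalIntegral.integral_of_le (by norm_num),
      intervalIntegral.integral_comp_sub_right (fun x => x ^ 2), integral_pow]
    norm_num

/-- for every bivariate copula `C`, `S(C,C) ≤ π/6`. -/
theorem stmt8 (C : Measure (Fin 2 → ℝ)) (hC : IsCopula 2 C) :
    S 2 C C ≤ Real.pi / 6 := by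
  haveI := hC.1
  obtain ⟨s0, i0, e0⟩ := marg C hC 0
  obtain ⟨s1, i1, e1⟩ := marg C hC 1
  have qi : Integrable qq C := (i0.add i1).const_mul _
  have qe : ∫ x, qq x ∂C = Real.pi / 24 := by
    unfold qq
    rw [integral_const_mul, integral_add i0 i1, e0, e1]; ring
  have hin : ∀ᵐ x ∂C, ∫ y, dist2 x y ∂C ≤ (qq x + Real.pi / 8) - ∫ y, KK x y ∂C := by
    filter_upwards [s0, s1] with x h0 h1
    have a1 : Integrable (fun y => qq x + qq y) C := (integrable_const _).add qi
    have a2 : Integrable (fun y => qq x + qq y + Real.pi / 12) C := a1.add (integrable_const _)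
    have : ∫ y, dist2 x y ∂C ≤ ∫ y, ((qq x + qq y + Real.pi / 12) - KK x y) ∂C := by
      apply integral_mono_of_nonneg
      · exact Filter.Eventually.of_forall fun y => Real.sqrt_nonneg _
      · exact a2.sub (KK_int C x)
      · filter_upwards [s0, s1] with y k0 k1
        exact pointwise x y h0 h1 k0 k1
    refine this.trans (le_of_eq ?_)
    rw [integral_sub a2 (KK_int C x), integral_add a1 (integrable_const _),
      integral_add (integrable_const _) qi, qe]
    simp
    ring
  have b1 : Integrable (fun x => qq x + Real.pi / 8) C := qi.add (integrable_const _)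
  have : S 2 C C ≤ ∫ x, ((qq x + Real.pi / 8) - ∫ y, KK x y ∂C) ∂C := by
    unfold S
    apply integral_mono_of_nonneg
    · exact Filter.Eventually.of_forall fun x => integral_nonneg fun y => Real.sqrt_nonneg _
    · exact b1.sub (KK_int_int C)
    · exact hin
  rw [integral_sub b1 (KK_int_int C), integral_add qi (integrable_const _), qe] at this
  simp at this
  have := KK_psd C
  linarith
end

section
/- For every copula C on [0,1]³, S(C,C) ≤ 2/3, where S(C,C) = ∫∫ ‖x−y‖₂ C(dx) C(dy). -/
open MeasureTheory Set

/-- cdf of the uniform law on `[-1/2,1/2]` -/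
noncomputable def GG (t : ℝ) : ℝ := max 0 (min 1 (t + 1 / 2))

noncomputable def ss (a t : ℝ) : ℝ := (if a < t then 1 else 0) - GG t

lemma GG_cont : Continuous GG := by unfold GG; fun_prop

lemma GG_neg (t : ℝ) : GG (-t) = 1 - GG t := by
  unfold GG
  rcases le_total 1 (t+1/2) with h | h <;> rcases le_total 0 (t+1/2) with h' | h'
  · rw [min_eq_left h, min_eq_right (by linarith), max_eq_left (by linarith), max_eq_right (by linarith)]; ring
  · linarith
  · rw [min_eq_right h, min_eq_right (by linarith), max_eq_right (by linarith), max_eq_right (by linarith)]; ring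
  · rw [min_eq_right h, min_eq_left (by linarith), max_eq_right (by linarith), max_eq_left (by linarith)]; ring

lemma GG_low {t : ℝ} (h : t ≤ -1/2) : GG t = 0 := by
  unfold GG; rw [min_eq_right (by linarith), max_eq_left (by linarith)]
lemma GG_mid {t : ℝ} (h : -1/2 ≤ t) (h' : t ≤ 1/2) : GG t = t + 1/2 := by
  unfold GG; rw [min_eq_right (by linarith), max_eq_right (by linarith)]
lemma GG_high {t : ℝ} (h : 1/2 ≤ t) : GG t = 1 := by
  unfold GG; rw [min_eq_left (by linarith), max_eq_right (by linarith)]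

lemma GG_nonneg (t : ℝ) : 0 ≤ GG t := le_max_left _ _
lemma GG_le (t : ℝ) : GG t ≤ 1 := max_le (by norm_num) (min_le_left _ _)

lemma ss_abs (a t : ℝ) : |ss a t| ≤ 1 := by
  have := GG_nonneg t; have := GG_le t
  unfold ss; rw [abs_le]; split_ifs <;> constructor <;> linarith

lemma ss_meas : Measurable (fun p : ℝ × ℝ => ss p.1 p.2) := by
  unfold ss
  refine Measurable.sub (Measurable.ite (measurableSet_lt measurable_fst measurable_snd) measurable_const measurable_const) (GG_cont.measurable.comp measurable_snd)

lemma ii (a b : ℝ) : IntervalIntegrable (fun t => GG t ^ 2) volume a b :=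
  (GG_cont.pow 2).intervalIntegrable _ _

lemma P_low {a : ℝ} (h : -1 ≤ a) (h' : a ≤ -1/2) : ∫ t in (-1)..a, GG t ^ 2 = 0 := by
  rw [intervalIntegral.integral_congr (g := fun _ => 0)]
  · simp
  · intro t ht
    rw [uIcc_of_le h] at ht
    simp [GG_low (ht.2.trans h')]

lemma P_mid {a : ℝ} (h : -1/2 ≤ a) (h' : a ≤ 1/2) : ∫ t in (-1)..a, GG t ^ 2 = (a+1/2)^3/3 := by
  rw [← intervalIntegral.integral_add_adjacent_intervals (ii (-1) (-1/2)) (ii (-1/2) a),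
    P_low (by norm_num) le_rfl,
    intervalIntegral.integral_congr (g := fun t => (t+1/2)^2)]
  · rw [intervalIntegral.integral_comp_add_right (fun t => t^2)]
    rw [integral_pow]; norm_num
  · intro t ht
    rw [uIcc_of_le h] at ht
    simp only
    rw [GG_mid ht.1 (ht.2.trans h')]

lemma P_high {a : ℝ} (h : 1/2 ≤ a) : ∫ t in (-1)..a, GG t ^ 2 = 1/3 + (a-1/2) := by
  rw [← intervalIntegral.integral_add_adjacent_intervals (ii (-1) (1/2)) (ii (1/2) a),
    P_mid (by norm_num) le_rfl,
    intervalIntegral.integral_congr (g := fun t => 1)]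
  · simp; norm_num
  · intro t ht
    rw [uIcc_of_le h] at ht
    simp only
    rw [GG_high ht.1]; norm_num

lemma P_neg (a : ℝ) : ∫ t in a..1, (1 - GG t) ^ 2 = ∫ t in (-1)..(-a), GG t ^ 2 := by
  rw [← intervalIntegral.integral_comp_neg]
  simp [GG_neg]

lemma PP {a : ℝ} (h : -1 ≤ a) (h' : a ≤ 1) :
    (∫ t in (-1)..a, GG t ^ 2) + ∫ t in a..1, (1 - GG t) ^ 2 ≤ a^2 + 1/12 := by
  rw [P_neg]
  rcases le_total a (-1/2) with h1 | h1
  · rw [P_low h h1, P_high (by linarith)]; nlinarith [sq_nonneg (a+1/2)]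
  rcases le_total a (1/2) with h2 | h2
  · rw [P_mid h1 h2, P_mid (by linarith) (by linarith)]; apply le_of_eq; ring
  · rw [P_high h2, P_low (by linarith) (by linarith)]; nlinarith [sq_nonneg (a-1/2)]

noncomputable def lam : Measure ℝ := volume.restrict (Ioc (-1) 1)

instance : IsFiniteMeasure lam := by unfold lam; infer_instance

lemma ss_int_sq (a b : ℝ) : Integrable (fun t => ss a t * ss b t) lam := by
  refine Integrable.of_bound (C := 1) ?_ (ae_of_all _ fun t => ?_)
  · have h1 : Measurable (fun t => ss a t) := ss_meas.comp (by fun_prop : Measurable fun t : ℝ => (a,t))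
    have h2 : Measurable (fun t => ss b t) := ss_meas.comp (by fun_prop : Measurable fun t : ℝ => (b,t))
    exact (h1.mul h2).aestronglyMeasurable
  · rw [norm_mul, Real.norm_eq_abs, Real.norm_eq_abs]
    exact mul_le_one₀ (ss_abs _ _) (abs_nonneg _) (ss_abs _ _)

lemma ss_sq {a : ℝ} (h : -1 ≤ a) (h' : a ≤ 1) : ∫ t, ss a t * ss a t ∂lam ≤ a^2 + 1/12 := by
  have hint : ∀ c d, c ∈ Icc (-1:ℝ) 1 → d ∈ Icc (-1:ℝ) 1 → c ≤ d →
      IntervalIntegrable (fun t => ss a t * ss a t) volume c d := by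
    intro c d hc hd hcd
    rw [intervalIntegrable_iff_integrableOn_Ioc_of_le hcd]
    exact IntegrableOn.mono_set (ss_int_sq a a) (Ioc_subset_Ioc hc.1 hd.2)
  refine le_trans (le_of_eq ?_) (PP h h')
  unfold lam
  rw [← intervalIntegral.integral_of_le (by norm_num),
    ← intervalIntegral.integral_add_adjacent_intervals (b := a)
      (hint _ _ (by simp) ⟨h, h'⟩ h) (hint _ _ ⟨h, h'⟩ (by simp) h')]
  rw [intervalIntegral.integral_of_le h, intervalIntegral.integral_of_le h',
    intervalIntegral.integral_of_le h, intervalIntegral.integral_of_le h']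
  congr 1
  · refine setIntegral_congr_fun measurableSet_Ioc fun t ht => ?_
    simp only [ss, if_neg (not_lt.2 ht.2)]; ring
  · refine setIntegral_congr_fun measurableSet_Ioc fun t ht => ?_
    simp only [ss, if_pos ht.1]; ring

lemma ss_diff {a b : ℝ} (h : -1 ≤ a) (h' : b ≤ 1) (hab : a ≤ b) :
    ∫ t, (ss a t - ss b t)^2 ∂lam = b - a := by
  have : ∀ t, (ss a t - ss b t)^2 = (Ioc a b).indicator (fun _ => (1:ℝ)) t := by
    intro t
    simp only [ss, indicator, mem_Ioc]
    by_cases h1 : a < t <;> by_cases h2 : b < t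
    · simp [h1, h2]
    · simp [h1, h2, not_lt.1 h2]
    · exact absurd (hab.trans_lt h2) h1
    · simp [h1, h2]
  simp_rw [this]
  rw [integral_indicator measurableSet_Ioc, lam, Measure.restrict_restrict measurableSet_Ioc,
    inter_eq_left.2 (Ioc_subset_Ioc h h')]
  simp [hab]

lemma kern {a b : ℝ} (ha : |a| ≤ 1) (hb : |b| ≤ 1) :
    |a - b| ≤ a^2 + b^2 + 1/6 - 2 * ∫ t, ss a t * ss b t ∂lam := by
  rw [abs_le] at ha hb
  have h1 : |a - b| = ∫ t, (ss a t - ss b t)^2 ∂lam := by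
    rcases le_total a b with h | h
    · rw [ss_diff ha.1 hb.2 h, abs_of_nonpos (by linarith)]; ring
    · rw [← abs_neg, neg_sub, abs_of_nonpos (by linarith)]
      have := ss_diff hb.1 ha.2 h
      rw [show (fun t => (ss a t - ss b t)^2) = fun t => (ss b t - ss a t)^2 by ext; ring, this]; ring
  have h2 : ∫ t, (ss a t - ss b t)^2 ∂lam = (∫ t, ss a t * ss a t ∂lam) + (∫ t, ss b t * ss b t ∂lam)
      - 2 * ∫ t, ss a t * ss b t ∂lam := by
    have hadd : Integrable (fun t => ss a t * ss a t + ss b t * ss b t) lam :=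
      (ss_int_sq _ _).add (ss_int_sq _ _)
    rw [← integral_add (ss_int_sq _ _) (ss_int_sq _ _), ← integral_const_mul,
      ← integral_sub hadd ((ss_int_sq _ _).const_mul 2)]
    congr 1; ext; ring
  have := ss_sq ha.1 ha.2
  have := ss_sq hb.1 hb.2
  linarith

variable {Ω : Type*} [MeasurableSpace Ω]

lemma oneD_s10 (C : Measure Ω) [IsProbabilityMeasure C] (f : Ω → ℝ) (hf : Measurable f)
    (hb : ∀ x, |f x| ≤ 1) :
    ∫ p, |f p.1 - f p.2| ∂(C.prod C) ≤ 2 * ∫ x, f x ^ 2 ∂C + 1/6 := by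
  have hm : Measurable (fun q : (Ω × Ω) × ℝ => ss (f q.1.1) q.2 * ss (f q.1.2) q.2) :=
    (ss_meas.comp (by fun_prop : Measurable fun q : (Ω × Ω) × ℝ => (f q.1.1, q.2))).mul
    (ss_meas.comp (by fun_prop : Measurable fun q : (Ω × Ω) × ℝ => (f q.1.2, q.2)))
  have hI : Integrable (fun q : (Ω × Ω) × ℝ => ss (f q.1.1) q.2 * ss (f q.1.2) q.2)
      ((C.prod C).prod lam) := by
    refine Integrable.of_bound hm.aestronglyMeasurable 1 (ae_of_all _ fun t => ?_)
    rw [norm_mul, Real.norm_eq_abs, Real.norm_eq_abs]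
    exact mul_le_one₀ (ss_abs _ _) (abs_nonneg _) (ss_abs _ _)
  have hpos : 0 ≤ ∫ p, ∫ t, ss (f p.1) t * ss (f p.2) t ∂lam ∂(C.prod C) := by
    rw [integral_integral_swap hI]
    refine integral_nonneg fun t => ?_
    have := integral_prod_mul (μ := C) (ν := C) (fun x => ss (f x) t) (fun x => ss (f x) t)
    simp only [Pi.zero_apply]
    rw [this]; exact mul_self_nonneg _
  have hsq : Integrable (fun x => f x ^ 2) C := by
    refine Integrable.of_bound (hf.pow_const 2).aestronglyMeasurable 1 (ae_of_all _ fun t => ?_)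
    rw [norm_pow, Real.norm_eq_abs]; exact pow_le_one₀ (abs_nonneg _) (hb t)
  have h1 : Integrable (fun p : Ω × Ω => f p.1 ^ 2) (C.prod C) := hsq.comp_fst C
  have h2 : Integrable (fun p : Ω × Ω => f p.2 ^ 2) (C.prod C) := hsq.comp_snd C
  have h3 : Integrable (fun p : Ω × Ω => 2 * ∫ t, ss (f p.1) t * ss (f p.2) t ∂lam) (C.prod C) :=
    hI.integral_prod_left.const_mul 2
  have hab : Integrable (fun p : Ω × Ω => |f p.1 - f p.2|) (C.prod C) := by
    refine Integrable.of_bound (by fun_prop) 2 (ae_of_all _ fun p => ?_)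
    rw [Real.norm_eq_abs, abs_abs]
    have := abs_sub (f p.1) (f p.2)
    linarith [hb p.1, hb p.2]
  have h12 : Integrable (fun p : Ω × Ω => f p.1 ^ 2 + f p.2 ^ 2) (C.prod C) := h1.add h2
  have h126 : Integrable (fun p : Ω × Ω => f p.1 ^ 2 + f p.2 ^ 2 + 1/6) (C.prod C) :=
    h12.add (integrable_const (1/6))
  have key := integral_mono hab (h126.sub h3)
    (fun p => kern (hb p.1) (hb p.2))
  refine key.trans ?_
  simp only [Pi.add_apply, Pi.sub_apply]
  rw [integral_sub h126 h3, integral_add h12 (integrable_const (1/6)),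
    integral_add h1 h2, integral_const_mul]
  have e1 : ∫ p : Ω × Ω, f p.1 ^ 2 ∂(C.prod C) = ∫ x, f x ^ 2 ∂C := by
    simpa using integral_fun_fst (μ := C) (ν := C) (fun x => f x ^ 2)
  have e2 : ∫ p : Ω × Ω, f p.2 ^ 2 ∂(C.prod C) = ∫ x, f x ^ 2 ∂C := by
    simpa using integral_fun_snd (μ := C) (ν := C) (fun x => f x ^ 2)
  rw [e1, e2]
  simp
  linarith

abbrev EE := EuclideanSpace ℝ (Fin 3)

lemma rint : ∫ y in Ioi (0:ℝ), y ^ 2 * (y * Real.exp (-y^2)) = 1/2 := by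
  have := integral_rpow_mul_exp_neg_rpow (p := 2) (q := 3) (by norm_num) (by norm_num)
  norm_num at this
  rw [← this]
  refine setIntegral_congr_fun measurableSet_Ioi fun y hy => ?_
  ring

lemma w_integral : ∫ u : EE, ‖u‖ * Real.exp (-‖u‖^2) = 2 * Real.pi := by
  have := integral_fun_norm_addHaar (volume : Measure EE) (fun y => y * Real.exp (-y^2))
  rw [this]
  simp only [finrank_euclideanSpace, Fintype.card_fin, smul_eq_mul, Nat.reduceSub, Measure.real,
    EuclideanSpace.volume_ball_fin_three, rint]
  rw [ENNReal.ofReal_one, one_pow, one_mul, ENNReal.toReal_ofReal (by positivity)]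
  ring

lemma w_integrable : Integrable (fun u : EE => ‖u‖ * Real.exp (-‖u‖^2)) := by
  by_contra h
  have := w_integral
  rw [integral_undef h] at this
  linarith [Real.pi_pos]

lemma rot (F : EE → EE → ℝ) (hF : ∀ (e : EE ≃ₗᵢ[ℝ] EE) x u, F (e x) (e u) = F x u) (x y : EE)
    (h : ‖x‖ = ‖y‖) : ∫ u, F x u = ∫ u, F y u := by
  let e := (ℝ ∙ (x - y))ᗮ.reflection
  have he : e x = y := Submodule.reflection_sub h
  rw [← (e.measurePreserving).integral_comp' (f := e.toMeasurableEquiv) (F y)]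
  rw [← he]
  congr 1; ext u
  exact (hF e x u).symm

lemma abs_gauss : ∫ t : ℝ, |t| * Real.exp (-t^2) = 1 := by
  have := integral_comp_abs (f := fun t => t * Real.exp (-t^2))
  simp only [sq_abs] at this
  rw [this]
  have := integral_rpow_mul_exp_neg_rpow (p := 2) (q := 1) (by norm_num) (by norm_num)
  norm_num at this
  rw [this]; norm_num

lemma I1e : ∫ u : EE, |u 0| * Real.exp (-‖u‖^2) = Real.pi := by
  rw [← (PiLp.volume_preserving_toLp (Fin 3)).integral_comp (MeasurableEquiv.toLp 2 (Fin 3 → ℝ)).measurableEmbedding]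
  have := integral_fintype_prod_volume_eq_prod (ι := Fin 3) (E := fun _ => ℝ) (𝕜 := ℝ)
    (fun i t => if i = 0 then |t| * Real.exp (-t^2) else Real.exp (-t^2))
  simp only [Fin.prod_univ_three] at this
  simp only [if_true, Fin.reduceEq, if_false, one_ne_zero] at this
  have g : ∫ t : ℝ, Real.exp (-t^2) = √Real.pi := by simpa using integral_gaussian 1
  rw [abs_gauss, g, one_mul, Real.mul_self_sqrt Real.pi_pos.le] at this
  rw [← this]
  congr 1; ext u
  rw [EuclideanSpace.norm_sq_eq, Fin.sum_univ_three, neg_add, neg_add, Real.exp_add, Real.exp_add]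
  simp
  ring

lemma I1 (x : EE) : ∫ u : EE, |inner ℝ x u| * Real.exp (-‖u‖^2) = Real.pi * ‖x‖ := by
  rw [rot (fun x u => |inner ℝ x u| * Real.exp (-‖u‖^2)) (by simp) x (‖x‖ • EuclideanSpace.single 0 1)
    (by simp [norm_smul])]
  simp only [inner_smul_left, EuclideanSpace.inner_single_left]
  simp only [abs_mul, mul_assoc]
  rw [integral_const_mul]
  simp [I1e, mul_comm]

lemma I2int (x : EE) : Integrable (fun u : EE => (inner ℝ x u)^2 / ‖u‖ * Real.exp (-‖u‖^2)) := by
  refine (w_integrable.const_mul (‖x‖^2)).mono' (by fun_prop) (ae_of_all _ fun u => ?_)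
  rw [Real.norm_eq_abs, abs_of_nonneg (by positivity), ← mul_assoc]
  gcongr
  apply div_le_of_le_mul₀ (norm_nonneg _) (by positivity)
  have := abs_real_inner_le_norm x u
  rw [← sq_abs]
  calc _ ≤ (‖x‖ * ‖u‖)^2 := by gcongr
    _ = _ := by ring

lemma I2 (x : EE) : ∫ u : EE, (inner ℝ x u)^2 / ‖u‖ * Real.exp (-‖u‖^2) = 2 * Real.pi / 3 * ‖x‖^2 := by
  let F : EE → EE → ℝ := fun x u => (inner ℝ x u)^2 / ‖u‖ * Real.exp (-‖u‖^2)
  have hF : ∀ (e : EE ≃ₗᵢ[ℝ] EE) x u, F (e x) (e u) = F x u := by simp [F]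
  have key : ∀ i : Fin 3, ∫ u, F (EuclideanSpace.single i 1) u = ∫ u, F (EuclideanSpace.single 0 1) u :=
    fun i => rot F hF _ _ (by simp)
  have hs : ∑ i : Fin 3, ∫ u, F (EuclideanSpace.single i 1) u = 2 * Real.pi := by
    rw [← integral_finsetSum _ (fun i _ => I2int _), ← w_integral]
    congr 1; ext u
    simp only [F, EuclideanSpace.inner_single_left]
    rw [← Finset.sum_mul, ← Finset.sum_div]
    have : ∑ i : Fin 3, ((starRingEnd ℝ) 1 * u i)^2 = ‖u‖^2 := by
      rw [EuclideanSpace.norm_sq_eq]; simp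
    rw [this]
    congr 1
    by_cases h : ‖u‖ = 0
    · simp [h]
    · field_simp
  simp only [key, Finset.sum_const, Finset.card_univ, Fintype.card_fin] at hs
  have h0 : ∫ u, F x u = ∫ u, F (‖x‖ • EuclideanSpace.single 0 1) u := rot F hF _ _ (by simp [norm_smul])
  have h1 : ∀ u, F (‖x‖ • EuclideanSpace.single 0 1) u = ‖x‖^2 * F (EuclideanSpace.single 0 1) u := by
    intro u; simp only [F, inner_smul_left]; simp; ring
  simp only [h1, integral_const_mul] at h0
  change ∫ u, F x u = _
  rw [h0]
  simp at hs
  linear_combination ‖x‖^2 / 3 * hs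

lemma step (C : Measure Ω) [IsProbabilityMeasure C] (X : Ω → EE) (hX : Measurable X)
    (hb : ∀ x, ‖X x‖ ≤ 1) (u : EE) :
    ∫ p, |inner ℝ (X p.1 - X p.2) u| ∂(C.prod C) ≤
      2 * ∫ x, (inner ℝ (X x) u) ^ 2 / ‖u‖ ∂C + ‖u‖ / 6 := by
  by_cases hu : u = 0
  · simp [hu]
  have hu' : 0 < ‖u‖ := norm_pos_iff.2 hu
  have h := oneD_s10 C (fun x => inner ℝ (X x) u / ‖u‖) (by fun_prop) (fun x => by
    rw [abs_div, abs_norm, div_le_one hu']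
    exact (abs_real_inner_le_norm _ _).trans (mul_le_of_le_one_left hu'.le (hb x)))
  have e1 : ∀ p : Ω × Ω, |inner ℝ (X p.1) u / ‖u‖ - inner ℝ (X p.2) u / ‖u‖|
      = ‖u‖⁻¹ * |inner ℝ (X p.1 - X p.2) u| := by
    intro p
    rw [← sub_div, ← inner_sub_left, abs_div, abs_norm, div_eq_inv_mul]
  have e2 : ∀ x, (inner ℝ (X x) u / ‖u‖) ^ 2 = ‖u‖⁻¹ * ((inner ℝ (X x) u) ^ 2 / ‖u‖) := by
    intro x; field_simp
  simp only [e1, e2, integral_const_mul] at h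
  have := mul_le_mul_of_nonneg_left h hu'.le
  rw [mul_inv_cancel_left₀ hu'.ne'] at this
  refine this.trans (le_of_eq ?_)
  field_simp

lemma vecIneq (C : Measure Ω) [IsProbabilityMeasure C] (X : Ω → EE) (hX : Measurable X)
    (hb : ∀ x, ‖X x‖ ≤ 1) :
    ∫ p, ‖X p.1 - X p.2‖ ∂(C.prod C) ≤ 4 / 3 * ∫ x, ‖X x‖ ^ 2 ∂C + 1 / 3 := by
  have hA : Integrable (fun q : EE × (Ω × Ω) =>
      |inner ℝ (X q.2.1 - X q.2.2) q.1| * Real.exp (-‖q.1‖^2)) (volume.prod (C.prod C)) := by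
    refine (w_integrable.mul_prod (integrable_const (2:ℝ))).mono' (by fun_prop)
      (ae_of_all _ fun q => ?_)
    rw [Real.norm_eq_abs, abs_of_nonneg (by positivity)]
    have h1 := abs_real_inner_le_norm (X q.2.1 - X q.2.2) q.1
    have h2 : ‖X q.2.1 - X q.2.2‖ ≤ 2 := (norm_sub_le _ _).trans (by linarith [hb q.2.1, hb q.2.2])
    calc _ ≤ (2 * ‖q.1‖) * Real.exp (-‖q.1‖^2) := by
          gcongr; exact h1.trans (by gcongr)
      _ = _ := by ring
  have hB : Integrable (fun q : EE × Ω =>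
      (inner ℝ (X q.2) q.1) ^ 2 / ‖q.1‖ * Real.exp (-‖q.1‖^2)) (volume.prod C) := by
    refine (w_integrable.mul_prod (integrable_const (1:ℝ))).mono' (by fun_prop)
      (ae_of_all _ fun q => ?_)
    rw [Real.norm_eq_abs, abs_of_nonneg (by positivity), mul_one]
    gcongr
    apply div_le_of_le_mul₀ (norm_nonneg _) (by positivity)
    have h1 := abs_real_inner_le_norm (X q.2) q.1
    rw [← sq_abs, ← sq]
    gcongr
    exact h1.trans (mul_le_of_le_one_left (norm_nonneg _) (hb _))
  have sA := integral_integral_swap (f := fun (u : EE) (p : Ω × Ω) =>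
      |inner ℝ (X p.1 - X p.2) u| * Real.exp (-‖u‖^2)) hA
  have sB := integral_integral_swap (f := fun (u : EE) (x : Ω) =>
      (inner ℝ (X x) u) ^ 2 / ‖u‖ * Real.exp (-‖u‖^2)) hB
  simp only [I1, I2, integral_const_mul] at sA sB
  have iB : Integrable (fun u : EE => 2 * ∫ x, (inner ℝ (X x) u) ^ 2 / ‖u‖ * Real.exp (-‖u‖^2) ∂C) :=
    hB.integral_prod_left.const_mul 2
  have iw : Integrable (fun u : EE => 1 / 6 * (‖u‖ * Real.exp (-‖u‖^2))) := w_integrable.const_mul _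
  have key := integral_mono hA.integral_prod_left (iB.add iw) (fun u => by
    have := mul_le_mul_of_nonneg_right (step C X hX hb u) (Real.exp_pos (-‖u‖^2)).le
    simp only [Pi.add_apply, integral_mul_const]
    linarith)
  simp only [Pi.add_apply] at key
  rw [integral_add iB iw, integral_const_mul, integral_const_mul, w_integral, sA, sB] at key
  have hpi := Real.pi_pos
  refine le_of_mul_le_mul_left (key.trans (le_of_eq ?_)) hpi
  ring

noncomputable def cl (t : ℝ) : ℝ := max 0 (min 1 t) - 1 / 2

lemma cl_cont : Continuous cl := by unfold cl; fun_prop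

lemma cl_eq {t : ℝ} (h : t ∈ Icc (0:ℝ) 1) : cl t = t - 1/2 := by
  unfold cl; rw [min_eq_right h.2, max_eq_right h.1]

lemma cl_sq (t : ℝ) : cl t ^ 2 ≤ 1/4 := by
  have h1 : 0 ≤ max 0 (min 1 t) := le_max_left _ _
  have h2 : max 0 (min 1 t) ≤ 1 := max_le (by norm_num) (min_le_left _ _)
  unfold cl; nlinarith

noncomputable def XX (x : Fin 3 → ℝ) : EE := WithLp.toLp 2 (fun i => cl (x i))

lemma XX_meas : Measurable XX := by
  have : Continuous XX := by
    unfold XX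
    have := cl_cont
    fun_prop
  exact this.measurable

lemma XX_norm (x) : ‖XX x‖ ^ 2 = ∑ i, cl (x i) ^ 2 := by
  rw [EuclideanSpace.norm_sq_eq]; simp [XX]

lemma XX_le (x) : ‖XX x‖ ≤ 1 := by
  have := XX_norm x
  rw [Fin.sum_univ_three] at this
  have h0 := cl_sq (x 0)
  have h1 := cl_sq (x 1)
  have h2 := cl_sq (x 2)
  nlinarith [norm_nonneg (XX x)]

lemma cl_integral : ∫ t, cl t ^ 2 ∂uniform01 = 1/12 := by
  unfold uniform01
  rw [setIntegral_congr_fun measurableSet_Icc (g := fun t => (t - 1/2)^2)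
    (fun t ht => by simp only [cl_eq ht]), integral_Icc_eq_integral_Ioc,
    ← intervalIntegral.integral_of_le (by norm_num),
    intervalIntegral.integral_comp_sub_right (fun t => t^2), integral_pow]
  norm_num

/-- for every trivariate copula `C`, `S(C,C) ≤ 2/3`. -/
theorem stmt10 (C : Measure (Fin 3 → ℝ)) (hC : IsCopula 3 C) :
    S 3 C C ≤ 2 / 3 := by
  obtain ⟨hP, hM⟩ := hC
  have hae : ∀ᵐ x ∂C, ∀ i, x i ∈ Icc (0:ℝ) 1 := by
    rw [ae_all_iff]
    intro i
    have h : ∀ᵐ t ∂(Measure.map (fun x : Fin 3 → ℝ => x i) C), t ∈ Icc (0:ℝ) 1 := by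
      rw [hM i]; exact ae_restrict_mem measurableSet_Icc
    exact ae_of_ae_map (measurable_pi_apply i).aemeasurable h
  have hS : S 3 C C = ∫ x, ∫ y, ‖XX x - XX y‖ ∂C ∂C := by
    unfold S
    refine integral_congr_ae ?_
    filter_upwards [hae] with x hx
    refine integral_congr_ae ?_
    filter_upwards [hae] with y hy
    rw [dist2, EuclideanSpace.norm_eq]
    congr 1
    refine Finset.sum_congr rfl fun i _ => ?_
    simp [XX, cl_eq (hx i), cl_eq (hy i)]
  have hI : Integrable (fun p : (Fin 3 → ℝ) × (Fin 3 → ℝ) => ‖XX p.1 - XX p.2‖) (C.prod C) := by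
    have := XX_meas
    refine Integrable.of_bound (by fun_prop) 2 (ae_of_all _ fun p => ?_)
    rw [norm_norm]
    exact (norm_sub_le _ _).trans (by linarith [XX_le p.1, XX_le p.2])
  have hV := vecIneq C XX XX_meas XX_le
  rw [integral_prod _ hI] at hV
  have hsq : ∫ x, ‖XX x‖ ^ 2 ∂C = 1/4 := by
    simp only [XX_norm]
    rw [integral_finsetSum]
    · have : ∀ i : Fin 3, ∫ x, cl (x i) ^ 2 ∂C = 1/12 := by
        intro i
        rw [← cl_integral, ← hM i, integral_map (measurable_pi_apply i).aemeasurable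
          (cl_cont.pow 2).aestronglyMeasurable]
      simp only [this]; norm_num
    · intro i _
      refine Integrable.of_bound
        ((cl_cont.comp (continuous_apply i)).pow 2).aestronglyMeasurable (1/4) (ae_of_all _ fun x => ?_)
      rw [Real.norm_eq_abs, abs_of_nonneg (sq_nonneg _)]
      exact cl_sq _
  rw [hS]
  rw [hsq] at hV
  linarith
end
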